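/- arXiv:1912.00555 — 3 statements merged into one kernel-verified Lean document; each statement's English description precedes it below -/
import Mathlib

section
/- For every real number d > 0, as n → ∞ one has the asymptotic equivalence s_d(n) ∼ ( (√(d+1) − √d)·d^{1/4} / (2·(d+1)^{3/4}·π^{1/2}) ) · n^{−3/2} · (2d+1+2√(d²+d))^n, i.e., the ratio of the two sides tends to 1. -/
open scoped Classical

/-- `s(n,k)`: `s(1,0) = 1`, `s(1,k) = 0` for `k ≥ 1`, and
`s(n,k) = (1/(n-1)) * C(n-1,k) * C(n+k-1,n)` for `n ≥ 2`. -/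
noncomputable def schroederS (n k : ℕ) : ℝ :=
  if n = 1 then (if k = 0 then 1 else 0)
  else (1 / ((n : ℝ) - 1)) * ((n - 1).choose k) * ((n + k - 1).choose n)

/-- Weighted small Schröder number `s_d(n) = Σ_{k=0}^{n-1} s(n,k) d^k`. -/
noncomputable def sd (d : ℝ) (n : ℕ) : ℝ :=
  ∑ k ∈ Finset.range n, schroederS n k * d ^ k

open Filter Finset Topology PowerSeries

section Recurrence

lemma schroederS_zero_right {n : ℕ} (hn : 2 ≤ n) : schroederS n 0 = 0 := by
  have h : (n - 1).choose n = 0 := Nat.choose_eq_zero_of_lt (by omega)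
  simp [schroederS, show n ≠ 1 by omega, h]

lemma schroederS_eq_zero_of_le {n k : ℕ} (hn : 1 ≤ n) (hk : n ≤ k) : schroederS n k = 0 := by
  have h : (n - 1).choose k = 0 := Nat.choose_eq_zero_of_lt (by omega)
  simp only [schroederS, h]
  split_ifs <;> first | omega | simp

lemma sd_eq_sum_range {d : ℝ} {n N : ℕ} (hn : 1 ≤ n) (hN : n ≤ N) :
    sd d n = ∑ k ∈ range N, schroederS n k * d ^ k := by
  refine sum_subset (range_subset_range.2 hN) fun k _ hk ↦ ?_
  rw [schroederS_eq_zero_of_le hn (by simpa using hk), zero_mul]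

lemma sd_eq_sum_range_succ {d : ℝ} {n N : ℕ} (hn : 2 ≤ n) (hN : n ≤ N + 1) :
    sd d n = ∑ k ∈ range N, schroederS n (k + 1) * d ^ (k + 1) := by
  rw [sd_eq_sum_range (by omega) hN, sum_range_succ', schroederS_zero_right hn]
  simp

lemma schroederS_recurrence (m k : ℕ) :
    ((m : ℝ) + 3) * schroederS (m + 3) (k + 1) =
      (2 * m + 3) * (2 * schroederS (m + 2) k + schroederS (m + 2) (k + 1))
        - m * schroederS (m + 1) (k + 1) := by
  have e1 : ((m + 1).choose (k + 1) : ℝ) = (m + 1 - k) / (m + 2) * (m + 2).choose (k + 1) := by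
    have := Nat.choose_mul_succ_eq (m + 1) (k + 1)
    rcases le_or_gt k (m + 1) with h | h
    · zify [show k + 1 ≤ m + 1 + 1 by omega] at this
      have h' : ((m + 1).choose (k + 1) : ℝ) * (m + 1 + 1) =
        (m + 2).choose (k + 1) * (m + 1 + 1 - (k + 1)) := by exact_mod_cast this
      field_simp
      linarith
    · rw [Nat.choose_eq_zero_of_lt (by omega : m + 1 < k + 1),
        Nat.choose_eq_zero_of_lt (by omega : m + 2 < k + 1)]
      simp
  have e2 : (m.choose (k + 1) : ℝ) = (m - k) / (m + 1) * (m + 1).choose (k + 1) := by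
    have := Nat.choose_mul_succ_eq m (k + 1)
    rcases le_or_gt k m with h | h
    · zify [show k + 1 ≤ m + 1 by omega] at this
      have h' : (m.choose (k + 1) : ℝ) * (m + 1) =
        (m + 1).choose (k + 1) * (m + 1 - (k + 1)) := by exact_mod_cast this
      field_simp
      linarith
    · rw [Nat.choose_eq_zero_of_lt (by omega : m < k + 1),
        Nat.choose_eq_zero_of_lt (by omega : m + 1 < k + 1)]
      simp
  have e3 : ((m + 1).choose k : ℝ) = (k + 1) / (m + 2) * (m + 2).choose (k + 1) := by
    have : ((m + 1 : ℕ) + 1 : ℝ) * (m + 1).choose k = (m + 2).choose (k + 1) * (k + 1) := by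
      exact_mod_cast Nat.add_one_mul_choose_eq (m + 1) k
    push_cast at this
    field_simp
    linarith
  have f1 : ((m + k + 2).choose (m + 2) : ℝ) =
      (m + k + 2) / (m + 2) * (m + k + 1).choose (m + 1) := by
    have : ((m + k + 1 : ℕ) + 1 : ℝ) * (m + k + 1).choose (m + 1) =
        (m + k + 2).choose (m + 2) * ((m + 1 : ℕ) + 1) := by
      exact_mod_cast Nat.add_one_mul_choose_eq (m + k + 1) (m + 1)
    push_cast at this
    field_simp
    linarith
  have f2 : ((m + k + 3).choose (m + 3) : ℝ) =
      (m + k + 3) / (m + 3) * (m + k + 2).choose (m + 2) := by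
    have : ((m + k + 2 : ℕ) + 1 : ℝ) * (m + k + 2).choose (m + 2) =
        (m + k + 3).choose (m + 3) * ((m + 2 : ℕ) + 1) := by
      exact_mod_cast Nat.add_one_mul_choose_eq (m + k + 2) (m + 2)
    push_cast at this
    field_simp
    linarith
  have f3 : ((m + k + 1).choose (m + 2) : ℝ) = k / (m + 2) * (m + k + 1).choose (m + 1) := by
    have h := Nat.choose_succ_right_eq (m + k + 1) (m + 1)
    rw [show m + k + 1 - (m + 1) = k by omega] at h
    have : ((m + k + 1).choose (m + 2) : ℝ) * ((m + 1 : ℕ) + 1) =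
        (m + k + 1).choose (m + 1) * k := by
      exact_mod_cast h
    push_cast at this
    field_simp
    linarith
  have s1 : schroederS (m + 3) (k + 1) =
      1 / (m + 2) * (m + 2).choose (k + 1) * (m + k + 3).choose (m + 3) := by
    rw [schroederS, if_neg (by omega), show m + 3 + (k + 1) - 1 = m + k + 3 by omega]
    push_cast
    ring
  have s2 : schroederS (m + 2) (k + 1) =
      1 / (m + 1) * (m + 1).choose (k + 1) * (m + k + 2).choose (m + 2) := by
    rw [schroederS, if_neg (by omega), show m + 2 + (k + 1) - 1 = m + k + 2 by omega]
    push_cast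
    ring
  have s3 : schroederS (m + 2) k =
      1 / (m + 1) * (m + 1).choose k * (m + k + 1).choose (m + 2) := by
    rw [schroederS, if_neg (by omega), show m + 2 + k - 1 = m + k + 1 by omega]
    push_cast
    ring
  have s4 : m * schroederS (m + 1) (k + 1) =
      m.choose (k + 1) * (m + k + 1).choose (m + 1) := by
    rcases Nat.eq_zero_or_pos m with rfl | hm
    · simp
    · have : (m : ℝ) ≠ 0 := by positivity
      rw [schroederS, if_neg (by omega), show m + 1 + (k + 1) - 1 = m + k + 1 by omega]
      push_cast
      rw [add_sub_cancel_right]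
      field_simp
  rw [s1, s2, s3, s4, f2, f1, f3, e2, e1, e3]
  field_simp
  ring

lemma sd_recurrence (d : ℝ) (m : ℕ) :
    ((m : ℝ) + 3) * sd d (m + 3) =
      (2 * d + 1) * (2 * m + 3) * sd d (m + 2) - m * sd d (m + 1) := by
  have h1 : (m : ℝ) * sd d (m + 1) =
      m * ∑ k ∈ range (m + 2), schroederS (m + 1) (k + 1) * d ^ (k + 1) := by
    rcases Nat.eq_zero_or_pos m with rfl | hm
    · simp
    · rw [sd_eq_sum_range_succ (N := m + 2) (by omega) (by omega)]
  have h2 : (2 * d + 1) * (2 * m + 3) * sd d (m + 2) =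
      (2 * m + 3) * (2 * d * ∑ k ∈ range (m + 2), schroederS (m + 2) k * d ^ k
        + ∑ k ∈ range (m + 2), schroederS (m + 2) (k + 1) * d ^ (k + 1)) := by
    rw [← sd_eq_sum_range (by omega) le_rfl, ← sd_eq_sum_range_succ (by omega) (by omega)]
    ring
  rw [h1, h2, sd_eq_sum_range_succ (N := m + 2) (by omega) (by omega)]
  simp only [mul_sum, ← sum_add_distrib, ← sum_sub_distrib]
  refine sum_congr rfl fun k _ ↦ ?_
  linear_combination d ^ (k + 1) * schroederS_recurrence m k

lemma sd_two (d : ℝ) : sd d 2 = d := by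
  simp [sd, sum_range_succ, schroederS]
  norm_num

end Recurrence

section SqrtSeries

/-- The Taylor coefficients of `√(1 - x)` at `0`. -/
noncomputable def sqrtCoeff (n : ℕ) : ℝ :=
  -(n.centralBinom : ℝ) / (4 ^ n * (2 * n - 1))

lemma two_mul_natCast_sub_one_ne_zero (n : ℕ) : (2 * n - 1 : ℝ) ≠ 0 := by
  intro h
  have : (2 * n : ℝ) = 1 := by linarith
  have : 2 * n = 1 := by exact_mod_cast this
  omega

lemma sqrtCoeff_zero : sqrtCoeff 0 = 1 := by simp [sqrtCoeff]

lemma sqrtCoeff_succ (n : ℕ) :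
    (n + 1) * sqrtCoeff (n + 1) = (n - 1 / 2) * sqrtCoeff n := by
  have h : ((n : ℝ) + 1) * (n + 1).centralBinom = 2 * (2 * n + 1) * n.centralBinom := by
    exact_mod_cast Nat.succ_mul_centralBinom_succ n
  have h0 := two_mul_natCast_sub_one_ne_zero n
  have h1 : (2 * n + 1 : ℝ) ≠ 0 := by positivity
  have h2 : (2 * (n + 1 : ℕ) - 1 : ℝ) = 2 * n + 1 := by push_cast; ring
  rw [sqrtCoeff, sqrtCoeff, h2, pow_succ, show (n - 1 / 2 : ℝ) = (2 * n - 1) / 2 by ring]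
  generalize (2 * n - 1 : ℝ) = x at h0 ⊢
  field_simp
  linear_combination -2 * h

lemma sqrtCoeff_succ_nonpos (n : ℕ) : sqrtCoeff (n + 1) ≤ 0 := by
  have h2 : (2 * (n + 1 : ℕ) - 1 : ℝ) = 2 * n + 1 := by push_cast; ring
  rw [sqrtCoeff, h2, neg_div]
  exact neg_nonpos.2 (by positivity)

lemma sum_range_succ_sqrtCoeff (n : ℕ) :
    ∑ m ∈ range (n + 1), sqrtCoeff m = n.centralBinom / 4 ^ n := by
  induction n with
  | zero => simp [sqrtCoeff_zero]
  | succ n ih =>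
    have h : ((n : ℝ) + 1) * (n + 1).centralBinom = 2 * (2 * n + 1) * n.centralBinom := by
      exact_mod_cast Nat.succ_mul_centralBinom_succ n
    have h1 : (2 * n + 1 : ℝ) ≠ 0 := by positivity
    have h2 : (2 * (n + 1 : ℕ) - 1 : ℝ) = 2 * n + 1 := by push_cast; ring
    rw [sum_range_succ, ih, sqrtCoeff, h2, pow_succ]
    field_simp
    linear_combination -2 * h

/-- The formal power series of `√(1 - x)`. -/
noncomputable def sqrtSeries : PowerSeries ℝ := PowerSeries.mk sqrtCoeff

lemma one_sub_X_mul_derivative_sqrtSeries :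
    (1 - X) * (d⁄dX ℝ sqrtSeries) = -(C (1 / 2 : ℝ) * sqrtSeries) := by
  ext n
  have h := sqrtCoeff_succ n
  rw [sub_mul, one_mul, map_sub, map_neg, coeff_C_mul]
  cases n with
  | zero =>
    simp [coeff_derivative, sqrtSeries] at h ⊢
    linarith
  | succ n =>
    rw [coeff_succ_X_mul]
    simp [coeff_derivative, sqrtSeries] at h ⊢
    linarith

lemma sqrtSeries_mul_self : sqrtSeries * sqrtSeries = 1 - X := by
  set F := sqrtSeries * sqrtSeries with hF
  have hode : (1 - X) * (d⁄dX ℝ F) = -F := by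
    have h := one_sub_X_mul_derivative_sqrtSeries
    have hc : (2 : PowerSeries ℝ) * C (1 / 2 : ℝ) = 1 := by
      rw [← map_ofNat C 2, ← map_mul]; norm_num
    rw [hF, Derivation.leibniz]
    simp only [smul_eq_mul]
    linear_combination 2 * sqrtSeries * h - sqrtSeries ^ 2 * hc
  have hrec (n : ℕ) : (n + 1) * coeff (n + 1) F = (n - 1) * coeff n F := by
    have h := congrArg (coeff n) hode
    rw [sub_mul, one_mul, map_sub, map_neg] at h
    cases n with
    | zero => simp [coeff_derivative] at h ⊢; linarith
    | succ n =>
      rw [coeff_succ_X_mul] at h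
      simp only [coeff_derivative] at h
      push_cast at h ⊢
      linarith
  have h0 : coeff 0 F = 1 := by simp [hF, sqrtSeries, sqrtCoeff_zero]
  have h1 : coeff 1 F = -1 := by simpa [h0] using hrec 0
  have h2 (n : ℕ) : coeff (n + 2) F = 0 := by
    induction n with
    | zero => simpa using hrec 1
    | succ n ih =>
      have h := hrec (n + 2)
      rw [ih, mul_zero] at h
      exact (mul_eq_zero.1 h).resolve_left (by positivity)
  ext n
  match n with
  | 0 => simpa using h0
  | 1 => simpa [coeff_one] using h1
  | n + 2 => simp [h2, coeff_one, coeff_X]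

end SqrtSeries

section Asymptotics

/-- The sequence `(n + 1) ^ (3 / 2)`. -/
noncomputable def threeHalvesWeight (n : ℕ) : ℝ := (n + 1) * √(n + 1)

lemma threeHalvesWeight_pos (n : ℕ) : 0 < threeHalvesWeight n := by
  unfold threeHalvesWeight; positivity

lemma one_le_threeHalvesWeight (n : ℕ) : 1 ≤ threeHalvesWeight n := by
  have h : (1 : ℝ) ≤ n + 1 := by simp
  have : 1 ≤ √((n : ℝ) + 1) := Real.one_le_sqrt.2 h
  unfold threeHalvesWeight
  nlinarith

lemma threeHalvesWeight_add_le (i j : ℕ) :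
    threeHalvesWeight (i + j) ≤ threeHalvesWeight i * threeHalvesWeight j := by
  have h : ((i + j : ℕ) : ℝ) + 1 ≤ (i + 1) * (j + 1) := by
    push_cast
    nlinarith [(Nat.cast_nonneg i : (0 : ℝ) ≤ i), (Nat.cast_nonneg j : (0 : ℝ) ≤ j)]
  calc threeHalvesWeight (i + j) ≤ ((i + 1) * (j + 1)) * √((i + 1) * (j + 1)) := by
        unfold threeHalvesWeight; gcongr
    _ = threeHalvesWeight i * threeHalvesWeight j := by
        rw [Real.sqrt_mul (by positivity)]; unfold threeHalvesWeight; ring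

lemma tendsto_natCast_add_div_natCast (a : ℝ) :
    Tendsto (fun n : ℕ ↦ ((n : ℝ) + a) / n) atTop (𝓝 1) := by
  have h := (tendsto_const_div_atTop_nhds_zero_nat a).const_add 1
  rw [add_zero] at h
  refine h.congr' ?_
  filter_upwards [eventually_gt_atTop 0] with n hn
  field_simp

lemma tendsto_threeHalvesWeight_div_mul_sqrt :
    Tendsto (fun n : ℕ ↦ threeHalvesWeight n / (n * √n)) atTop (𝓝 1) := by
  have h := tendsto_natCast_add_div_natCast 1
  have h' := h.mul h.sqrt
  simp only [Real.sqrt_one, mul_one] at h'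
  refine h'.congr fun n ↦ ?_
  rw [Real.sqrt_div (by positivity), threeHalvesWeight]
  ring

lemma tendsto_threeHalvesWeight_add_div (m : ℕ) :
    Tendsto (fun n ↦ threeHalvesWeight (n + m) / threeHalvesWeight n) atTop (𝓝 1) := by
  have h : Tendsto (fun n : ℕ ↦ ((n : ℝ) + 1 + m) / (n + 1)) atTop (𝓝 1) := by
    simpa using (tendsto_add_atTop_iff_nat 1).2 (tendsto_natCast_add_div_natCast m)
  have h' := h.mul h.sqrt
  simp only [Real.sqrt_one, mul_one] at h'
  refine h'.congr fun n ↦ ?_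
  rw [Real.sqrt_div (by positivity), threeHalvesWeight, threeHalvesWeight, div_mul_div_comm]
  push_cast
  rw [add_right_comm]

lemma tendsto_centralBinom_mul_sqrt :
    Tendsto (fun n : ℕ ↦ (n.centralBinom : ℝ) * √n / 4 ^ n) atTop (𝓝 (1 / √Real.pi)) := by
  have hS := Stirling.tendsto_stirlingSeq_sqrt_pi
  have h2 : Tendsto (fun n : ℕ ↦ 2 * n) atTop atTop :=
    tendsto_id.const_mul_atTop' (by norm_num)
  have hpi : √Real.pi ≠ 0 := by positivity
  have h := (hS.comp h2).div (hS.pow 2) (by positivity)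
  have hlim : √Real.pi / √Real.pi ^ 2 = 1 / √Real.pi := by field_simp
  rw [hlim] at h
  refine h.congr' ?_
  filter_upwards [eventually_gt_atTop 0] with n hn
  have hn' : (0 : ℝ) < n := by exact_mod_cast hn
  have hc : ((2 * n).factorial : ℝ) = n.centralBinom * n.factorial * n.factorial := by
    have := Nat.choose_mul_factorial_mul_factorial (show n ≤ 2 * n by omega)
    rw [show 2 * n - n = n by omega] at this
    rw [Nat.centralBinom, ← this]
    push_cast
    ring
  have hs : √(2 * (2 * n : ℝ)) = 2 * √n := by
    rw [show 2 * (2 * n : ℝ) = 2 ^ 2 * n by ring, Real.sqrt_mul (by positivity),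
      Real.sqrt_sq (by norm_num)]
  have hs2 : √(2 * n : ℝ) ^ 2 = 2 * n := Real.sq_sqrt (by positivity)
  have hsn : √(n : ℝ) ^ 2 = n := Real.sq_sqrt (by positivity)
  have hsp : 0 < √(n : ℝ) := Real.sqrt_pos.2 hn'
  have hf : (n.factorial : ℝ) ≠ 0 := by positivity
  have h4 : (4 : ℝ) ^ n = 2 ^ (n * 2) := by rw [mul_comm, pow_mul]; norm_num
  simp only [Pi.div_apply, Function.comp, Stirling.stirlingSeq]
  push_cast
  rw [hc, hs, div_pow, div_pow, mul_pow (√_), hs2, h4, mul_pow 2 _ (2 * n),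
    ← pow_mul, div_pow, mul_comm 2 n]
  field_simp
  linear_combination -(n.centralBinom : ℝ) * hsn

lemma tendsto_weight_mul_sqrtCoeff :
    Tendsto (fun n ↦ threeHalvesWeight n * sqrtCoeff n) atTop (𝓝 (-(1 / (2 * √Real.pi)))) := by
  have h1 : Tendsto (fun n : ℕ ↦ (n : ℝ) / (2 * n - 1)) atTop (𝓝 (1 / 2)) := by
    have h := ((tendsto_natCast_add_div_natCast (-1 / 2)).inv₀ one_ne_zero).mul_const
      (1 / 2)
    simp only [inv_one, one_mul] at h
    refine h.congr fun n ↦ ?_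
    rw [inv_div, div_mul_div_comm]
    congr 1 <;> ring
  have h := ((tendsto_threeHalvesWeight_div_mul_sqrt.mul tendsto_centralBinom_mul_sqrt).mul h1).neg
  have hlim : -(1 * (1 / √Real.pi) * (1 / 2)) = -(1 / (2 * √Real.pi)) := by ring
  rw [hlim] at h
  refine h.congr' ?_
  filter_upwards [eventually_gt_atTop 0] with n hn
  have hn' : (0 : ℝ) < n := by exact_mod_cast hn
  have hsp : 0 < √(n : ℝ) := Real.sqrt_pos.2 hn'
  have := two_mul_natCast_sub_one_ne_zero n
  rw [sqrtCoeff]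
  field_simp

lemma exists_abs_weight_mul_sqrtCoeff_le :
    ∃ K, ∀ n, threeHalvesWeight n * |sqrtCoeff n| ≤ K := by
  obtain ⟨K, hK⟩ := (Metric.isBounded_range_of_tendsto _
    tendsto_weight_mul_sqrtCoeff).exists_norm_le
  refine ⟨K, fun n ↦ ?_⟩
  have := hK _ ⟨n, rfl⟩
  rwa [Real.norm_eq_abs, abs_mul, abs_of_pos (threeHalvesWeight_pos n)] at this

lemma summable_norm_sqrtCoeff_mul_pow {q : ℝ} (hq : 0 ≤ q) (hq1 : q < 1) :
    Summable fun n ↦ ‖sqrtCoeff n * q ^ n‖ := by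
  obtain ⟨K, hK⟩ := exists_abs_weight_mul_sqrtCoeff_le
  refine Summable.of_nonneg_of_le (fun _ ↦ norm_nonneg _) (fun n ↦ ?_)
    ((summable_geometric_of_lt_one hq hq1).mul_left K)
  rw [norm_mul, norm_pow, Real.norm_of_nonneg hq, Real.norm_eq_abs]
  gcongr
  exact (le_mul_of_one_le_left (abs_nonneg _) (one_le_threeHalvesWeight n)).trans (hK n)

lemma sum_antidiagonal_sqrtCoeff (n : ℕ) :
    ∑ p ∈ antidiagonal n, sqrtCoeff p.1 * sqrtCoeff p.2 = coeff n (1 - X : PowerSeries ℝ) := by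
  rw [← sqrtSeries_mul_self, coeff_mul]
  simp [sqrtSeries]

lemma tsum_sqrtCoeff_mul_pow {q : ℝ} (hq : 0 ≤ q) (hq1 : q < 1) :
    ∑' n, sqrtCoeff n * q ^ n = √(1 - q) := by
  have hs := summable_norm_sqrtCoeff_mul_pow hq hq1
  have hnonneg : 0 ≤ ∑' n, sqrtCoeff n * q ^ n := by
    have ht := (tendsto_add_atTop_iff_nat 1).2 hs.of_norm.hasSum.tendsto_sum_nat
    refine ge_of_tendsto' ht fun N ↦ ?_
    calc (0 : ℝ) ≤ N.centralBinom / 4 ^ N := by positivity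
      _ = ∑ m ∈ range (N + 1), sqrtCoeff m := (sum_range_succ_sqrtCoeff N).symm
      _ ≤ ∑ m ∈ range (N + 1), sqrtCoeff m * q ^ m := by
        refine sum_le_sum fun m _ ↦ ?_
        cases m with
        | zero => simp
        | succ m =>
          exact le_mul_of_le_one_right (sqrtCoeff_succ_nonpos m) (pow_le_one₀ hq hq1.le)
  have hsq : (∑' n, sqrtCoeff n * q ^ n) * ∑' n, sqrtCoeff n * q ^ n = 1 - q := by
    rw [tsum_mul_tsum_eq_tsum_sum_antidiagonal_of_summable_norm hs hs]
    have (n : ℕ) : ∑ p ∈ antidiagonal n, sqrtCoeff p.1 * q ^ p.1 * (sqrtCoeff p.2 * q ^ p.2) =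
        coeff n (1 - X : PowerSeries ℝ) * q ^ n := by
      rw [← sum_antidiagonal_sqrtCoeff, sum_mul]
      refine sum_congr rfl fun p hp ↦ ?_
      rw [← mem_antidiagonal.1 hp, pow_add]
      ring
    simp_rw [this]
    rw [tsum_eq_sum (s := range 2)]
    · simp [sum_range_succ, coeff_one]
      ring
    · intro n hn
      have : 1 < n := by simpa using hn
      simp [coeff_one, coeff_X, show n ≠ 0 by omega, show n ≠ 1 by omega]
  rw [← hsq, Real.sqrt_mul_self hnonneg]

lemma tendsto_weight_mul_convolution {q : ℝ} (hq : 0 ≤ q) (hq1 : q < 1) :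
    Tendsto (fun n ↦ threeHalvesWeight n *
        ∑ m ∈ range (n + 1), sqrtCoeff (n - m) * (sqrtCoeff m * q ^ m))
      atTop (𝓝 (-(1 / (2 * √Real.pi)) * √(1 - q))) := by
  obtain ⟨K, hK⟩ := exists_abs_weight_mul_sqrtCoeff_le
  have hK0 : 0 ≤ K :=
    (mul_nonneg (threeHalvesWeight_pos 0).le (abs_nonneg _)).trans (hK 0)
  set f : ℕ → ℕ → ℝ := fun n m ↦
    if m ≤ n then threeHalvesWeight n * (sqrtCoeff (n - m) * (sqrtCoeff m * q ^ m)) else 0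
    with hf
  have hsum (n : ℕ) : ∑' m, f n m = threeHalvesWeight n *
      ∑ m ∈ range (n + 1), sqrtCoeff (n - m) * (sqrtCoeff m * q ^ m) := by
    rw [tsum_eq_sum (s := range (n + 1)), mul_sum]
    · exact sum_congr rfl fun m hm ↦ if_pos (by simpa [Nat.lt_succ_iff] using hm)
    · exact fun m hm ↦ if_neg (by simpa [Nat.lt_succ_iff] using hm)
  simp_rw [← hsum]
  rw [← tsum_sqrtCoeff_mul_pow hq hq1, ← tsum_mul_left]
  refine tendsto_tsum_of_dominated_convergence (bound := fun m ↦ K * K * q ^ m)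
    ((summable_geometric_of_lt_one hq hq1).mul_left _) (fun m ↦ ?_) (Eventually.of_forall ?_)
  · rw [← tendsto_add_atTop_iff_nat m]
    have h := ((tendsto_threeHalvesWeight_add_div m).mul tendsto_weight_mul_sqrtCoeff).mul_const
      (sqrtCoeff m * q ^ m)
    rw [one_mul] at h
    refine h.congr fun n ↦ ?_
    have := (threeHalvesWeight_pos n).ne'
    simp only [hf, Nat.le_add_left, if_true, Nat.add_sub_cancel]
    field_simp
  · intro n m
    by_cases hmn : m ≤ n
    · obtain ⟨i, rfl⟩ := Nat.exists_eq_add_of_le' hmn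
      simp only [hf, hmn, if_true, Nat.add_sub_cancel, norm_mul, norm_pow, Real.norm_eq_abs,
        abs_of_pos (threeHalvesWeight_pos _), abs_of_nonneg hq]
      calc threeHalvesWeight (i + m) * (|sqrtCoeff i| * (|sqrtCoeff m| * q ^ m))
          ≤ threeHalvesWeight i * threeHalvesWeight m *
              (|sqrtCoeff i| * (|sqrtCoeff m| * q ^ m)) := by
            gcongr; exact threeHalvesWeight_add_le i m
        _ = threeHalvesWeight i * |sqrtCoeff i| * (threeHalvesWeight m * |sqrtCoeff m|) *
              q ^ m := by ring
        _ ≤ K * K * q ^ m := by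
            have := threeHalvesWeight_pos m
            gcongr
            · exact hK i
            · exact hK m
    · simp only [hf, hmn, if_false, norm_zero]
      positivity

end Asymptotics

section SqrtQuadratic

/-- The formal power series of `√((1 - a x) (1 - b x))`. -/
noncomputable def sqrtQuadratic (a b : ℝ) : PowerSeries ℝ :=
  rescale a sqrtSeries * rescale b sqrtSeries

lemma sqrtQuadratic_mul_self (a b : ℝ) :
    sqrtQuadratic a b * sqrtQuadratic a b = (1 - C a * X) * (1 - C b * X) := by
  have h (c : ℝ) : rescale c sqrtSeries * rescale c sqrtSeries = 1 - C c * X := by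
    rw [← map_mul, sqrtSeries_mul_self, map_sub, map_one, rescale_X]
  rw [sqrtQuadratic, ← h a, ← h b]
  ring

lemma sqrtQuadratic_ode (t : ℝ) {a b : ℝ} (hab : a * b = 1) (hsum : a + b = 2 * t) :
    (1 - C (2 * t) * X + X ^ 2) * (d⁄dX ℝ (sqrtQuadratic a b)) =
      (X - C t) * sqrtQuadratic a b := by
  set A := sqrtQuadratic a b with hA
  have hsq : A * A = 1 - C (2 * t) * X + X ^ 2 := by
    have h1 : (C a * C b : PowerSeries ℝ) = 1 := by rw [← map_mul, hab, map_one]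
    rw [hA, sqrtQuadratic_mul_self, ← hsum, map_add]
    linear_combination X ^ 2 * h1
  have hder : A * (d⁄dX ℝ A) = X - C t := by
    have h := congrArg (d⁄dX ℝ) hsq
    simp only [Derivation.leibniz, map_add, map_sub, smul_eq_mul, derivative_C, derivative_X,
      Derivation.leibniz_pow, Derivation.map_one_eq_zero, map_mul] at h
    have hc : (C (2 : ℝ) : PowerSeries ℝ) = 2 := map_ofNat C 2
    have hc' : (2 : PowerSeries ℝ) * C (1 / 2 : ℝ) = 1 := by
      rw [← hc, ← map_mul]; norm_num
    rw [hc] at h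
    simp at h
    linear_combination C (1 / 2 : ℝ) * h - (A * (d⁄dX ℝ A) - (X - C t)) * hc'
  rw [← hsq]
  linear_combination A * hder

lemma coeff_sqrtQuadratic_recurrence (t : ℝ) {a b : ℝ} (hab : a * b = 1) (hsum : a + b = 2 * t)
    (n : ℕ) :
    (n + 2) * coeff (n + 2) (sqrtQuadratic a b) =
      t * (2 * n + 1) * coeff (n + 1) (sqrtQuadratic a b)
        - (n - 1) * coeff n (sqrtQuadratic a b) := by
  have h := congrArg (coeff (n + 1)) (sqrtQuadratic_ode t hab hsum)
  set A := sqrtQuadratic a b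
  rw [add_mul, sub_mul, one_mul, sub_mul, map_add, map_sub, map_sub, mul_assoc, coeff_C_mul,
    coeff_C_mul, coeff_succ_X_mul, coeff_succ_X_mul, pow_two, mul_assoc X X,
    coeff_succ_X_mul] at h
  cases n with
  | zero =>
    simp [coeff_derivative] at h ⊢
    linarith
  | succ n =>
    rw [coeff_succ_X_mul] at h
    simp only [coeff_derivative] at h
    push_cast at h ⊢
    linarith

lemma coeff_zero_sqrtQuadratic (a b : ℝ) : coeff 0 (sqrtQuadratic a b) = 1 := by
  have h (c : ℝ) : coeff 0 (rescale c sqrtSeries) = 1 := by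
    rw [coeff_rescale]
    simp [sqrtSeries, sqrtCoeff_zero]
  rw [sqrtQuadratic, coeff_mul, Nat.antidiagonal_zero, sum_singleton, h, h, one_mul]

lemma coeff_one_sqrtQuadratic (t : ℝ) {a b : ℝ} (hab : a * b = 1) (hsum : a + b = 2 * t) :
    coeff 1 (sqrtQuadratic a b) = -t := by
  have h := congrArg (coeff 0) (sqrtQuadratic_ode t hab hsum)
  have h0 := coeff_zero_sqrtQuadratic a b
  have h1 := coeff_derivative (sqrtQuadratic a b) 0
  simp at h h0 h1
  rw [← h1, h, h0, mul_one]

lemma coeff_sqrtQuadratic_eq (a b : ℝ) (ha : a ≠ 0) (n : ℕ) :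
    coeff n (sqrtQuadratic a b) =
      a ^ n * ∑ m ∈ range (n + 1), sqrtCoeff (n - m) * (sqrtCoeff m * (b / a) ^ m) := by
  rw [sqrtQuadratic, mul_comm, coeff_mul,
    Nat.sum_antidiagonal_eq_sum_range_succ_mk, mul_sum]
  refine sum_congr rfl fun m hm ↦ ?_
  have hm' : m ≤ n := by simpa [Nat.lt_succ_iff] using hm
  obtain ⟨i, rfl⟩ := Nat.exists_eq_add_of_le' hm'
  simp only [coeff_rescale, sqrtSeries, coeff_mk, Nat.add_sub_cancel, div_pow, pow_add]
  field_simp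

lemma sd_eq_coeff_sqrtQuadratic {d a b : ℝ} (hd : 0 < d) (hab : a * b = 1)
    (hsum : a + b = 2 * (2 * d + 1)) (n : ℕ) :
    sd d (n + 2) = -coeff (n + 2) (sqrtQuadratic a b) / (2 * (d + 1)) := by
  have hrec := coeff_sqrtQuadratic_recurrence (2 * d + 1) hab hsum
  have h2 : sd d 2 = -coeff 2 (sqrtQuadratic a b) / (2 * (d + 1)) := by
    have h := hrec 0
    simp only [zero_add, coeff_one_sqrtQuadratic _ hab hsum, coeff_zero_sqrtQuadratic] at h
    rw [sd_two]
    field_simp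
    norm_num at h
    linarith
  have h3 : sd d 3 = -coeff 3 (sqrtQuadratic a b) / (2 * (d + 1)) := by
    have h := hrec 1
    have h' := sd_recurrence d 0
    norm_num at h h'
    rw [h2] at h'
    field_simp at h' ⊢
    linarith
  suffices sd d (n + 2) = -coeff (n + 2) (sqrtQuadratic a b) / (2 * (d + 1)) ∧
      sd d (n + 3) = -coeff (n + 3) (sqrtQuadratic a b) / (2 * (d + 1)) from this.1
  induction n with
  | zero => exact ⟨h2, h3⟩
  | succ n ih =>
    refine ⟨ih.2, ?_⟩
    have h := hrec (n + 2)
    have h' := sd_recurrence d (n + 1)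
    rw [show n + 1 + 2 = n + 3 by ring, show n + 1 + 1 = n + 2 by ring, ih.1, ih.2] at h'
    push_cast at h h'
    have hn : (n + 1 + 3 : ℝ) ≠ 0 := by positivity
    refine mul_left_cancel₀ hn ?_
    rw [h']
    field_simp
    linear_combination h

end SqrtQuadratic

lemma natCast_rpow_neg_three_halves (n : ℕ) :
    (n : ℝ) ^ (-(3 : ℝ) / 2) = (n * √n)⁻¹ := by
  rw [neg_div, Real.rpow_neg n.cast_nonneg, show (3 : ℝ) / 2 = 1 + 1 / 2 by norm_num,
    Real.rpow_add_of_nonneg n.cast_nonneg zero_le_one (by norm_num), Real.rpow_one,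
    ← Real.sqrt_eq_rpow]

lemma schroeder_constant_eq {d : ℝ} (hd : 0 < d) :
    (√(d + 1) - √d) * d ^ ((1 : ℝ) / 4) /
        (2 * (d + 1) ^ ((3 : ℝ) / 4) * Real.pi ^ ((1 : ℝ) / 2)) =
      1 / (2 * √Real.pi) * √(1 - (√(d + 1) - √d) ^ 2 / (√(d + 1) + √d) ^ 2) /
        (2 * (d + 1)) := by
  set u := √(d + 1) with hu
  set v := √d with hv
  have hv0 : 0 < v := Real.sqrt_pos.2 hd
  have hu0 : 0 < u := Real.sqrt_pos.2 (by linarith)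
  have huv : v < u := Real.sqrt_lt_sqrt hd.le (by linarith)
  have hv2 : v ^ 2 = d := Real.sq_sqrt hd.le
  have hu2 : u ^ 2 = d + 1 := Real.sq_sqrt (by linarith)
  have h1 : d ^ ((1 : ℝ) / 4) = √v := by
    rw [hv, Real.sqrt_eq_rpow, Real.sqrt_eq_rpow, ← Real.rpow_mul hd.le]
    norm_num
  have h2 : (d + 1) ^ ((3 : ℝ) / 4) = u * √u := by
    rw [hu, Real.sqrt_eq_rpow, Real.sqrt_eq_rpow, ← Real.rpow_mul (by linarith),
      ← Real.rpow_add (by linarith)]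
    norm_num
  have h3 : √(1 - (u - v) ^ 2 / (u + v) ^ 2) = (u - v) * (2 * (√u * √v)) := by
    have hsu : √u ^ 2 = u := Real.sq_sqrt hu0.le
    have hsv : √v ^ 2 = v := Real.sq_sqrt hv0.le
    have : 1 - (u - v) ^ 2 / (u + v) ^ 2 = ((u - v) * (2 * (√u * √v))) ^ 2 := by
      rw [mul_pow, mul_pow, mul_pow, hsu, hsv]
      have hone : (u - v) * (u + v) = 1 := by linear_combination hu2 - hv2
      field_simp
      linear_combination (-4 * u * v * ((u - v) * (u + v) + 1)) * hone
    rw [this, Real.sqrt_sq (mul_nonneg (by linarith) (by positivity))]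
  rw [h1, h2, h3, ← Real.sqrt_eq_rpow, ← hu2]
  have hsu : √u ^ 2 = u := Real.sq_sqrt hu0.le
  have hsu0 : 0 < √u := Real.sqrt_pos.2 hu0
  field_simp
  linear_combination (v - u) * hsu

/-- Asymptotics: for `d > 0`,
`s_d(n) ∼ ((√(d+1) − √d)·d^{1/4} / (2(d+1)^{3/4}·π^{1/2})) · n^{−3/2} · (2d+1+2√(d²+d))ⁿ`,
i.e. the ratio of the two sides tends to 1. -/
theorem weighted_schroeder_asymptotic (d : ℝ) (hd : 0 < d) :
    Filter.Tendsto
      (fun n : ℕ =>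
        sd d n /
          (((Real.sqrt (d + 1) - Real.sqrt d) * d ^ ((1 : ℝ) / 4) /
              (2 * (d + 1) ^ ((3 : ℝ) / 4) * Real.pi ^ ((1 : ℝ) / 2))) *
            (n : ℝ) ^ (-(3 : ℝ) / 2) * (2 * d + 1 + 2 * Real.sqrt (d ^ 2 + d)) ^ n))
      Filter.atTop (nhds 1) := by
  set u := √(d + 1) with hu
  set v := √d with hv
  have hv0 : 0 < v := Real.sqrt_pos.2 hd
  have huv : v < u := Real.sqrt_lt_sqrt hd.le (by linarith)
  have hv2 : v ^ 2 = d := Real.sq_sqrt hd.le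
  have hu2 : u ^ 2 = d + 1 := Real.sq_sqrt (by linarith)
  have hw : √(d ^ 2 + d) = u * v := by
    rw [hu, hv, ← Real.sqrt_mul (by linarith)]
    ring_nf
  have hbase : 2 * d + 1 + 2 * √(d ^ 2 + d) = (u + v) ^ 2 := by
    rw [hw]
    linear_combination -hv2 - hu2
  have hab : (u + v) ^ 2 * (u - v) ^ 2 = 1 := by
    have : (u + v) * (u - v) = 1 := by linear_combination hu2 - hv2
    rw [← mul_pow, this, one_pow]
  have hsum : (u + v) ^ 2 + (u - v) ^ 2 = 2 * (2 * d + 1) := by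
    linear_combination 2 * hu2 + 2 * hv2
  have ha : 0 < (u + v) ^ 2 := by have := hv0.trans huv; positivity
  set q := (u - v) ^ 2 / (u + v) ^ 2 with hq
  have hq0 : 0 ≤ q := by positivity
  have hq1 : q < 1 := by
    rw [hq, div_lt_one ha]
    nlinarith [mul_pos hv0 (hv0.trans huv)]
  rw [schroeder_constant_eq hd, hbase]
  set c := 1 / (2 * √Real.pi) * √(1 - q) / (2 * (d + 1)) with hc
  have hc0 : c ≠ 0 := by
    have : 0 < √(1 - q) := Real.sqrt_pos.2 (by linarith)
    positivity
  have h := ((tendsto_weight_mul_convolution hq0 hq1).const_mul (-1 / (2 * (d + 1)))).div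
    (tendsto_threeHalvesWeight_div_mul_sqrt.const_mul c) (by simpa using hc0)
  have hlim : -1 / (2 * (d + 1)) * (-(1 / (2 * √Real.pi)) * √(1 - q)) / (c * 1) = 1 := by
    rw [div_eq_one_iff_eq (by simpa using hc0), hc]
    ring
  rw [hlim] at h
  refine h.congr' ?_
  filter_upwards [eventually_ge_atTop 2] with n hn
  obtain ⟨m, rfl⟩ := Nat.exists_eq_add_of_le' hn
  rw [sd_eq_coeff_sqrtQuadratic hd hab hsum, coeff_sqrtQuadratic_eq _ _ ha.ne', ← hq,
    natCast_rpow_neg_three_halves]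
  have hwt := (threeHalvesWeight_pos (m + 2)).ne'
  have hpw := (pow_pos ha (m + 2)).ne'
  simp only [Pi.div_apply]
  field_simp
end

section
/- For every integer n ≥ 2, the n-th large Schröder number 2·s(n) is congruent to 2 modulo 4; that is, there exists an integer m with 2·s(n) = m and m ≡ 2 (mod 4). -/
open scoped Classical

/-- Vandermonde's identity in the form used to pass from the `f`-vector to the `h`-vector of the
associahedron. -/
theorem choose_add_eq_sum_choose_mul_choose (m k : ℕ) (hk : k ≤ m) :
    (m + k).choose (m + 1) = ∑ i ∈ Finset.range m, m.choose i * k.choose (i + 1) := by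
  rcases k with _ | k
  · simp
  have hsymm : (m + (k + 1)).choose (m + 1) = (m + (k + 1)).choose k :=
    Nat.choose_symm_of_eq_add (by omega)
  rw [hsymm, Nat.add_choose_eq, Finset.Nat.sum_antidiagonal_eq_sum_range_succ_mk]
  have hsub : Finset.range k.succ ⊆ Finset.range m := Finset.range_subset_range.2 hk
  rw [← Finset.sum_subset hsub]
  · refine Finset.sum_congr rfl fun i hi => ?_
    have hik := Finset.mem_range.1 hi
    congr 1
    exact Nat.choose_symm_of_eq_add (by omega)
  · intro i _ hi
    rw [Finset.mem_range, not_lt] at hi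
    rw [Nat.choose_eq_zero_of_lt (show k + 1 < i + 1 by omega), mul_zero]

theorem sum_choose_mul_choose_eq (m j : ℕ) (hj : j ≤ m) :
    ∑ k ∈ Finset.range (m + 1), m.choose k * k.choose j = m.choose j * 2 ^ (m - j) := by
  obtain ⟨r, rfl⟩ := Nat.exists_eq_add_of_le hj
  rw [add_assoc, Finset.sum_range_add, Finset.sum_eq_zero, zero_add, Nat.add_sub_cancel_left,
    ← Nat.sum_range_choose, Finset.mul_sum]
  · refine Finset.sum_congr rfl fun k hk => ?_
    rw [Nat.choose_mul, Nat.add_sub_cancel_left, Nat.add_sub_cancel_left]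
    exact j.le_add_right k
  · intro k hk
    rw [Nat.choose_eq_zero_of_lt (Finset.mem_range.1 hk), mul_zero]

/-- Integrality of the Narayana numbers. -/
theorem dvd_choose_mul_choose_succ (m i : ℕ) : m ∣ m.choose i * m.choose (i + 1) := by
  rcases m with _ | p
  · simp
  rcases i with _ | i
  · simp
  zify
  refine ⟨(p.choose (i + 1) : ℤ) * (p + 1).choose (i + 1)
    - (p + 1).choose (i + 2) * p.choose i, ?_⟩
  have h1 : ((p : ℤ) + 1) * p.choose i = (p + 1).choose (i + 1) * (i + 1) := by
    exact_mod_cast Nat.add_one_mul_choose_eq p i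
  have h2 : ((p : ℤ) + 1) * p.choose (i + 1) = (p + 1).choose (i + 2) * (i + 2) := by
    exact_mod_cast Nat.add_one_mul_choose_eq p (i + 1)
  linear_combination (-((p + 1).choose (i + 1) : ℤ)) * h2 + ((p + 1).choose (i + 2) : ℤ) * h1

theorem sum_choose_mul_choose_add (m : ℕ) :
    ∑ k ∈ Finset.range (m + 1), m.choose k * (m + k).choose (m + 1) =
      ∑ i ∈ Finset.range m, m.choose i * m.choose (i + 1) * 2 ^ (m - (i + 1)) := by
  calc
    _ = ∑ k ∈ Finset.range (m + 1), ∑ i ∈ Finset.range m,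
          m.choose i * (m.choose k * k.choose (i + 1)) := by
      refine Finset.sum_congr rfl fun k hk => ?_
      rw [choose_add_eq_sum_choose_mul_choose m k (Nat.lt_succ_iff.1 (Finset.mem_range.1 hk)),
        Finset.mul_sum]
      exact Finset.sum_congr rfl fun i _ => by ring
    _ = _ := by
      rw [Finset.sum_comm]
      refine Finset.sum_congr rfl fun i hi => ?_
      rw [← Finset.mul_sum, sum_choose_mul_choose_eq m (i + 1) (Finset.mem_range.1 hi), mul_assoc]

theorem exists_odd_mul_eq_sum_choose_mul_choose_add (m : ℕ) (hm : 1 ≤ m) :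
    ∃ c : ℕ, Odd c ∧
      ∑ k ∈ Finset.range (m + 1), m.choose k * (m + k).choose (m + 1) = m * c := by
  choose a ha using dvd_choose_mul_choose_succ m
  obtain ⟨p, rfl⟩ := Nat.exists_eq_add_of_le' hm
  refine ⟨∑ i ∈ Finset.range (p + 1), a i * 2 ^ (p + 1 - (i + 1)), ?_, ?_⟩
  · have hlast : a p = 1 := by
      have h := ha p
      rw [Nat.choose_self, Nat.choose_succ_self_right, mul_one] at h
      exact (Nat.eq_of_mul_eq_mul_left p.succ_pos (by rw [mul_one]; exact h)).symm
    rw [Finset.sum_range_succ, hlast, Nat.sub_self, pow_zero, mul_one]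
    refine Even.add_one (Finset.even_sum _ fun i hi => ?_)
    have hip := Finset.mem_range.1 hi
    exact Even.mul_left (Even.pow_of_ne_zero even_two (by omega)) _
  · rw [sum_choose_mul_choose_add, Finset.mul_sum]
    exact Finset.sum_congr rfl fun i _ => by rw [ha, mul_assoc]

/-- For `n ≥ 2`, the large Schröder number `2·s(n)` is congruent to `2` mod `4`. -/
theorem large_schroeder_mod_four (n : ℕ) (hn : 2 ≤ n) :
    ∃ m : ℤ, 2 * ∑ k ∈ Finset.range n, schroederS n k = (m : ℝ) ∧ m % 4 = 2 := by
  obtain ⟨m, rfl⟩ := Nat.exists_eq_add_of_le' (show 1 ≤ n by omega)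
  obtain ⟨c, ⟨r, hr⟩, hc⟩ := exists_odd_mul_eq_sum_choose_mul_choose_add m (by omega)
  have hm : (m : ℝ) ≠ 0 := Nat.cast_ne_zero.2 (by omega)
  have hsum : ∑ k ∈ Finset.range (m + 1), schroederS (m + 1) k = (c : ℝ) := by
    apply mul_left_cancel₀ hm
    rw [Finset.mul_sum, ← Nat.cast_mul, ← hc, Nat.cast_sum]
    refine Finset.sum_congr rfl fun k _ => ?_
    rw [schroederS, if_neg (by omega), show m + 1 + k - 1 = m + k by omega, Nat.add_sub_cancel]
    push_cast
    rw [add_sub_cancel_right]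
    field_simp
  refine ⟨2 * c, ?_, by omega⟩
  rw [hsum]
  push_cast
  rfl
end

section
/- For all integers m, n ≥ 1, Σ_{P ∈ D_n} (m+1)^{V(P)} = m^{n−1}·s_{1/m}(n); equivalently, the number of Dyck paths in D_n in which each valley is painted one of m+1 colors equals m^{n−1}·s_{1/m}(n). -/
open scoped Classical

/-- A Dyck path of length `m`, encoded as `P : Fin m → Bool` with `true` = up step `U`
and `false` = down step `D`: equal numbers of up and down steps, and every prefix has
at least as many up steps as down steps. -/
def IsDyck {m : ℕ} (P : Fin m → Bool) : Prop :=
  2 * (Finset.univ.filter fun i => P i = true).card = m ∧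
  ∀ j : Fin m,
    (Finset.univ.filter fun i => i ≤ j ∧ P i = false).card ≤
      (Finset.univ.filter fun i => i ≤ j ∧ P i = true).card

/-- `V(P)`: number of valleys (a down step immediately followed by an up step). -/
noncomputable def valleys {m : ℕ} (P : Fin m → Bool) : ℕ :=
  (Finset.univ.filter fun i : Fin m =>
    (if h : (i : ℕ) + 1 < m then !(P i) && P ⟨(i : ℕ) + 1, h⟩ else false) = true).card

/-- `K(P)`: number of peaks (an up step immediately followed by a down step). -/
noncomputable def peaks {m : ℕ} (P : Fin m → Bool) : ℕ :=
  (Finset.univ.filter fun i : Fin m =>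
    (if h : (i : ℕ) + 1 < m then P i && !(P ⟨(i : ℕ) + 1, h⟩) else false) = true).card

/-- Number of up steps. -/
noncomputable def ups {m : ℕ} (P : Fin m → Bool) : ℕ :=
  (Finset.univ.filter fun i => P i = true).card

/-- Number of down steps. -/
noncomputable def downs {m : ℕ} (P : Fin m → Bool) : ℕ :=
  (Finset.univ.filter fun i => P i = false).card

/-- Every prefix has at least as many up steps as down steps. -/
def IsBallot {m : ℕ} (P : Fin m → Bool) : Prop :=
  ∀ j : Fin m,
    (Finset.univ.filter fun i => i ≤ j ∧ P i = false).card ≤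
      (Finset.univ.filter fun i => i ≤ j ∧ P i = true).card

/-- The path `P` followed by the step `b`. -/
def addStep {m : ℕ} (P : Fin m → Bool) (b : Bool) : Fin (m + 1) → Bool :=
  Fin.snoc (α := fun _ => Bool) P b

@[simp] lemma addStep_castSucc {m : ℕ} (P : Fin m → Bool) (b : Bool) (i : Fin m) :
    addStep P b i.castSucc = P i :=
  Fin.snoc_castSucc (α := fun _ => Bool) b P i

@[simp] lemma addStep_last {m : ℕ} (P : Fin m → Bool) (b : Bool) :
    addStep P b (Fin.last m) = b :=
  Fin.snoc_last (α := fun _ => Bool) b P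

lemma addStep_mk {m : ℕ} (P : Fin m → Bool) (b : Bool) (i : ℕ) (hi : i < m + 1) :
    addStep P b ⟨i, hi⟩ = if h : i < m then P ⟨i, h⟩ else b :=
  rfl

lemma sum_addStep {m : ℕ} {A : Type*} [AddCommMonoid A] (f : (Fin (m + 1) → Bool) → A) :
    ∑ P, f P =
      ∑ P : Fin m → Bool, f (addStep P true) + ∑ P : Fin m → Bool, f (addStep P false) := by
  rw [← (Fin.snocEquiv fun _ : Fin (m + 1) => Bool).sum_comp, Fintype.sum_prod_type,
    Fintype.sum_bool]
  rfl

lemma card_filter_fin_succ {m : ℕ} (p : Fin (m + 1) → Prop) [DecidablePred p] :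
    (Finset.univ.filter p).card =
      (Finset.univ.filter fun i : Fin m => p i.castSucc).card + if p (Fin.last m) then 1 else 0 := by
  simp only [Finset.card_filter, Fin.sum_univ_castSucc]

lemma ups_addStep {m : ℕ} (P : Fin m → Bool) (b : Bool) :
    ups (addStep P b) = ups P + if b then 1 else 0 := by
  simp [ups, card_filter_fin_succ]

lemma downs_addStep {m : ℕ} (P : Fin m → Bool) (b : Bool) :
    downs (addStep P b) = downs P + if b then 0 else 1 := by
  cases b <;> simp [downs, card_filter_fin_succ]

lemma ups_add_downs {m : ℕ} (P : Fin m → Bool) : ups P + downs P = m := by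
  have h := Finset.card_filter_add_card_filter_not (s := (Finset.univ : Finset (Fin m)))
    (fun i => P i = true)
  simpa [ups, downs] using h

lemma isBallot_addStep {m : ℕ} (P : Fin m → Bool) (b : Bool) :
    IsBallot (addStep P b) ↔ IsBallot P ∧ downs (addStep P b) ≤ ups (addStep P b) := by
  simp [IsBallot, Fin.forall_fin_succ', card_filter_fin_succ, ups, downs, Fin.le_last]

lemma isDyck_iff {m : ℕ} (P : Fin m → Bool) : IsDyck P ↔ 2 * ups P = m ∧ IsBallot P := Iff.rfl

lemma valleys_addStep_addStep {m : ℕ} (P : Fin m → Bool) (a b : Bool) :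
    valleys (addStep (addStep P a) b) = valleys (addStep P a) + if !a && b then 1 else 0 := by
  unfold valleys
  rw [card_filter_fin_succ, card_filter_fin_succ, card_filter_fin_succ]
  simp [addStep_mk]

lemma valleys_le {m : ℕ} (P : Fin m → Bool) : valleys P ≤ m :=
  (Finset.card_filter_le _ _).trans (by simp)

/-- The number of ballot paths of length `M + 1` with last step `b`, having `u` up steps,
`d` down steps and `k` valleys. -/
noncomputable def ballotCount (M : ℕ) (b : Bool) (u d k : ℕ) : ℤ :=
  ∑ P : Fin M → Bool, if IsBallot (addStep P b) ∧ ups (addStep P b) = u ∧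
    downs (addStep P b) = d ∧ valleys (addStep P b) = k then 1 else 0

lemma ballotCount_eq_zero_of_lt {M u d : ℕ} (b : Bool) (k : ℕ) (h : u < d) :
    ballotCount M b u d k = 0 := by
  refine Finset.sum_eq_zero fun P _ => if_neg ?_
  rw [isBallot_addStep]
  omega

lemma ballotCount_false_zero (M u k : ℕ) : ballotCount M false u 0 k = 0 := by
  refine Finset.sum_eq_zero fun P _ => if_neg ?_
  simp [downs_addStep]

lemma ballotCount_true_succ_zero (M u d : ℕ) :
    ballotCount (M + 1) true (u + 1) d 0 = ballotCount M true u d 0 := by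
  rw [ballotCount, sum_addStep, ← add_zero (ballotCount M true u d 0), ballotCount]
  congr 1
  · refine Finset.sum_congr rfl fun P _ => if_congr ?_ rfl rfl
    rw [isBallot_addStep _ true, valleys_addStep_addStep, ups_addStep _ true, downs_addStep _ true,
      isBallot_addStep]
    simp
    omega
  · refine Finset.sum_eq_zero fun P _ => if_neg ?_
    rw [valleys_addStep_addStep]
    simp

lemma ballotCount_true_succ_succ (M u d k : ℕ) :
    ballotCount (M + 1) true (u + 1) d (k + 1) =
      ballotCount M true u d (k + 1) + ballotCount M false u d k := by
  rw [ballotCount, sum_addStep, ballotCount, ballotCount]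
  congr 1 <;> refine Finset.sum_congr rfl fun P _ => if_congr ?_ rfl rfl <;>
  · rw [isBallot_addStep _ true, valleys_addStep_addStep, ups_addStep _ true, downs_addStep _ true,
      isBallot_addStep]
    simp
    omega

lemma ballotCount_false_succ (M u d k : ℕ) (h : d + 1 ≤ u) :
    ballotCount (M + 1) false u (d + 1) k =
      ballotCount M true u d k + ballotCount M false u d k := by
  rw [ballotCount, sum_addStep, ballotCount, ballotCount]
  congr 1 <;> refine Finset.sum_congr rfl fun P _ => if_congr ?_ rfl rfl <;>
  · rw [isBallot_addStep _ false, valleys_addStep_addStep, ups_addStep _ false,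
      downs_addStep _ false, isBallot_addStep]
    simp
    omega

/-- Closed form for ballot paths ending with an up step. -/
def upFormula : ℕ → ℕ → ℕ → ℤ
  | _ + 1, 0, 0 => 1
  | a + 1, c + 1, j + 1 => a.choose (j + 1) * c.choose j - c.choose (j + 1) * a.choose j
  | _, _, _ => 0

/-- Closed form for ballot paths ending with a down step. -/
def downFormula : ℕ → ℕ → ℕ → ℤ
  | _ + 1, _ + 1, 0 => 1
  | a + 1, c + 1, j + 1 => a.choose (j + 1) * c.choose (j + 1) - c.choose (j + 2) * a.choose j
  | _, _, _ => 0

lemma upFormula_self (u k : ℕ) : upFormula u u k = 0 := by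
  rcases u with _ | u <;> rcases k with _ | k <;> simp [upFormula, mul_comm]

lemma ballotCount_zero_true (k : ℕ) : ballotCount 0 true 1 0 k = upFormula 1 0 k := by
  have hv (P : Fin 0 → Bool) : valleys (addStep P true) = 0 := by simp [valleys]
  have hu (P : Fin 0 → Bool) : ups (addStep P true) = 1 := by
    rw [ups_addStep]
    simp [ups]
  have hd (P : Fin 0 → Bool) : downs (addStep P true) = 0 := by
    rw [downs_addStep]
    simp [downs]
  have hb (P : Fin 0 → Bool) : IsBallot (addStep P true) :=
    (isBallot_addStep P true).2 ⟨fun j => j.elim0, by simp [hd]⟩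
  rcases k with _ | k <;> simp [ballotCount, hv, hu, hd, hb, upFormula]

theorem ballotCount_eq (M : ℕ) : ∀ u d k : ℕ, d ≤ u → u + d = M + 1 →
    ballotCount M true u d k = upFormula u d k ∧ ballotCount M false u d k = downFormula u d k := by
  induction M with
  | zero =>
    intro u d k hdu hM
    obtain rfl : d = 0 := by omega
    obtain rfl : u = 1 := by omega
    exact ⟨ballotCount_zero_true k, by rw [ballotCount_false_zero]; rfl⟩
  | succ M ih =>
    intro u d k hdu hM
    obtain ⟨u, rfl⟩ : ∃ v, u = v + 1 := ⟨u - 1, by omega⟩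
    constructor
    · rcases hdu.eq_or_lt with rfl | hlt
      · rw [upFormula_self]
        rcases k with _ | k
        · rw [ballotCount_true_succ_zero, ballotCount_eq_zero_of_lt _ _ (by omega)]
        · rw [ballotCount_true_succ_succ, ballotCount_eq_zero_of_lt _ _ (by omega),
            ballotCount_eq_zero_of_lt _ _ (by omega), add_zero]
      obtain ⟨u, rfl⟩ : ∃ v, u = v + 1 := ⟨u - 1, by omega⟩
      rcases k with _ | k
      · rw [ballotCount_true_succ_zero, (ih _ _ _ (by omega) (by omega)).1]
        rcases d with _ | d <;> rfl
      · rw [ballotCount_true_succ_succ, (ih _ _ _ (by omega) (by omega)).1,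
          (ih _ _ _ (by omega) (by omega)).2]
        rcases d with _ | d
        · rfl
        rcases k with _ | k <;> simp only [upFormula, downFormula, Nat.choose_succ_succ] <;>
          push_cast [Nat.choose_zero_right] <;> ring
    · rcases d with _ | d
      · rw [ballotCount_false_zero]; rfl
      · rw [ballotCount_false_succ _ _ _ _ hdu, (ih _ _ _ (by omega) (by omega)).1,
          (ih _ _ _ (by omega) (by omega)).2]
        rcases d with _ | d
        · rcases k with _ | k <;> simp [upFormula, downFormula]
        rcases k with _ | k
        · simp [upFormula, downFormula]
        · simp only [upFormula, downFormula, Nat.choose_succ_succ]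
          push_cast
          ring

lemma choose_succ_mul_cast (c j : ℕ) :
    (c.choose (j + 1) : ℤ) * (j + 1) = c.choose j * (c - j) := by
  rcases le_or_gt j c with h | h
  · have := Nat.choose_succ_right_eq c j
    zify [h] at this
    exact this
  · simp [Nat.choose_eq_zero_of_lt h, Nat.choose_eq_zero_of_lt (Nat.lt_succ_of_lt h)]

/-- The Narayana numbers. -/
lemma mul_downFormula_self (c k : ℕ) :
    ((c : ℤ) + 1) * downFormula (c + 1) (c + 1) k =
      (c + 1).choose (k + 1) * (c + 1).choose k := by
  rcases k with _ | j
  · simp [downFormula]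
  · have h1 := choose_succ_mul_cast c j
    have h2 := choose_succ_mul_cast c (j + 1)
    simp only [downFormula, Nat.choose_succ_succ c]
    push_cast at *
    linear_combination ((c.choose (j + 1) : ℤ) + c.choose (j + 2)) * h1 -
      ((c.choose (j + 1) : ℤ) + c.choose j) * h2

lemma sum_choose_mul_choose_mul_choose (N j : ℕ) (hj : j ≤ N) :
    ∑ k ∈ Finset.range (N + 1), N.choose (k + 1) * N.choose k * k.choose j =
      N.choose j * (2 * N - j).choose (N + 1) := by
  rw [show 2 * N - j = N + (N - j) by omega, Nat.add_choose_eq,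
    Finset.Nat.sum_antidiagonal_eq_sum_range_succ (fun a b => N.choose a * (N - j).choose b),
    Finset.sum_range_succ' _ (N + 1), Nat.choose_eq_zero_of_lt (show N - j < N + 1 - 0 by omega),
    mul_zero, add_zero, Finset.mul_sum]
  refine Finset.sum_congr rfl fun k hk => ?_
  have hk : k ≤ N := by simpa [Nat.lt_succ_iff] using hk
  suffices h : N.choose k * k.choose j = N.choose j * (N - j).choose (N - k) by
    rw [mul_assoc, h, Nat.add_sub_add_right]
    ring
  rcases le_or_gt j k with hjk | hjk
  · rw [Nat.choose_mul hjk, ← Nat.choose_symm (show k - j ≤ N - j by omega),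
      Nat.sub_sub_sub_cancel_right hjk]
  · rw [Nat.choose_eq_zero_of_lt hjk, Nat.choose_eq_zero_of_lt (show N - j < N - k by omega),
      mul_zero, mul_zero]

lemma sum_choose_mul_choose_mul_pow (N : ℕ) (x : ℝ) :
    ∑ k ∈ Finset.range (N + 1), (N.choose (k + 1) : ℝ) * N.choose k * (x + 1) ^ k =
      ∑ k ∈ Finset.range (N + 1), (N.choose k : ℝ) * (N + k).choose (N + 1) * x ^ (N - k) := by
  have hpow (k : ℕ) (hk : k ∈ Finset.range (N + 1)) :
      (x + 1) ^ k = ∑ j ∈ Finset.range (N + 1), x ^ j * k.choose j := by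
    rw [add_pow]
    simp only [one_pow, mul_one]
    refine Finset.sum_subset (by simpa [Nat.lt_succ_iff] using hk) fun j _ hj => ?_
    rw [Nat.choose_eq_zero_of_lt (by simpa using hj), Nat.cast_zero, mul_zero]
  rw [Finset.sum_congr rfl fun k hk => by rw [hpow k hk, Finset.mul_sum], Finset.sum_comm,
    ← Finset.sum_range_reflect]
  refine Finset.sum_congr rfl fun k hk => ?_
  have hk : k ≤ N := by simpa [Nat.lt_succ_iff] using hk
  have h := congrArg (Nat.cast : ℕ → ℝ)
    (sum_choose_mul_choose_mul_choose N (N - k) (Nat.sub_le _ _))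
  rw [show 2 * N - (N - k) = N + k by omega, Nat.choose_symm hk] at h
  push_cast at h
  rw [show N + 1 - 1 - k = N - k by omega, ← h, Finset.sum_mul]
  exact Finset.sum_congr rfl fun i _ => by ring

lemma sum_ballotCount_mul_pow (M : ℕ) (b : Bool) (u d : ℕ) (x : ℝ) :
    ∑ k ∈ Finset.range (M + 2), (ballotCount M b u d k : ℝ) * x ^ k =
      ∑ P : Fin M → Bool, if IsBallot (addStep P b) ∧ ups (addStep P b) = u ∧
        downs (addStep P b) = d then x ^ valleys (addStep P b) else 0 := by
  simp only [ballotCount, Int.cast_sum, Finset.sum_mul]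
  rw [Finset.sum_comm]
  refine Finset.sum_congr rfl fun P _ => ?_
  have hv : valleys (addStep P b) ∈ Finset.range (M + 2) := by
    have := valleys_le (addStep P b)
    rw [Finset.mem_range]
    omega
  split_ifs with h
  · rw [Finset.sum_eq_single_of_mem _ hv fun k _ hk => by simp [Ne.symm hk]]
    simp [h]
  · refine Finset.sum_eq_zero fun k _ => ?_
    rw [if_neg (by tauto), Int.cast_zero, zero_mul]

lemma sum_isDyck (c : ℕ) (x : ℝ) :
    ∑ P ∈ Finset.univ.filter (fun P : Fin (2 * c + 1 + 1) → Bool => IsDyck P), x ^ valleys P =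
      ∑ k ∈ Finset.range (2 * c + 3), (downFormula (c + 1) (c + 1) k : ℝ) * x ^ k := by
  have hdyck (P : Fin (2 * c + 1 + 1) → Bool) :
      IsDyck P ↔ IsBallot P ∧ ups P = c + 1 ∧ downs P = c + 1 := by
    have := ups_add_downs P
    rw [isDyck_iff, and_comm, and_congr_right_iff]
    intro _
    omega
  have h (k : ℕ) := ballotCount_eq (2 * c + 1) (c + 1) (c + 1) k le_rfl (by omega)
  simp only [hdyck]
  rw [Finset.sum_filter, sum_addStep, ← sum_ballotCount_mul_pow, ← sum_ballotCount_mul_pow]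
  simp only [h, upFormula_self, Int.cast_zero, zero_mul, Finset.sum_const_zero, zero_add]

lemma succ_mul_sum_isDyck (c : ℕ) (x : ℝ) :
    ((c : ℝ) + 1) * ∑ P ∈ Finset.univ.filter
        (fun P : Fin (2 * c + 1 + 1) → Bool => IsDyck P), x ^ valleys P =
      ∑ k ∈ Finset.range (c + 2), ((c + 1).choose (k + 1) : ℝ) * (c + 1).choose k * x ^ k := by
  have h (k : ℕ) : ((c : ℝ) + 1) * downFormula (c + 1) (c + 1) k =
      (c + 1).choose (k + 1) * (c + 1).choose k := mod_cast mul_downFormula_self c k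
  rw [sum_isDyck, Finset.mul_sum]
  simp only [← mul_assoc, h]
  refine (Finset.sum_subset (Finset.range_subset_range.2 (by omega)) fun k _ hk => ?_).symm
  rw [Nat.choose_eq_zero_of_lt (by simp at hk; omega), Nat.cast_zero, zero_mul, zero_mul]

/-- For `m, n ≥ 1`: `Σ_{P ∈ D_n} (m+1)^{V(P)} = m^{n−1}·s_{1/m}(n)`. -/
theorem colored_valley_count (m n : ℕ) (hm : 1 ≤ m) (hn : 1 ≤ n) :
    ∑ P ∈ Finset.univ.filter (fun P : Fin (2 * (n - 1)) → Bool => IsDyck P),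
        ((m : ℝ) + 1) ^ valleys P
      = (m : ℝ) ^ (n - 1) * sd (1 / (m : ℝ)) n := by
  obtain ⟨N, rfl⟩ : ∃ N, n = N + 1 := ⟨n - 1, by omega⟩
  rcases N with _ | c
  · have hdyck (P : Fin (2 * (0 + 1 - 1)) → Bool) : IsDyck P :=
      ⟨by simp, fun j => (Nat.not_lt_zero _ j.2).elim⟩
    have hval (P : Fin (2 * (0 + 1 - 1)) → Bool) : valleys P = 0 :=
      Nat.le_zero.1 (valleys_le P)
    simp [hdyck, hval, sd, schroederS]
  have hm' : (m : ℝ) ≠ 0 := by positivity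
  have hc : (c : ℝ) + 1 ≠ 0 := by positivity
  refine mul_left_cancel₀ hc ((succ_mul_sum_isDyck c _).trans ?_)
  rw [sum_choose_mul_choose_mul_pow, sd, Finset.mul_sum, Finset.mul_sum]
  refine Finset.sum_congr rfl fun k hk => ?_
  have hk : k ≤ c + 1 := by simpa [Nat.lt_succ_iff] using hk
  rw [schroederS, if_neg (by omega), show c + 1 + 1 + k - 1 = c + 1 + k by omega,
    Nat.add_sub_cancel, one_div (m : ℝ), inv_pow, pow_sub₀ _ hm' hk]
  push_cast
  field_simp
  ring
end
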